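/- arXiv:1704.01630 — 2 statements merged into one kernel-verified Lean document; each statement's English description precedes it below -/
import Mathlib

section
/- Let R be a ring and fix a universe of R-modules. Call a function α assigning to every R-module a value in ℕ ∪ {∞} a sum-sup invariant if for every family (M_i)_{i∈I} of R-modules one has α(⨁_{i∈I} M_i) = sup_{i∈I} α(M_i). Let α and β be sum-sup invariants. Then the following are equivalent: (a) every R-module M with β(M) < ∞ also satisfies α(M) < ∞; (b) there exists a function f : ℕ → ℕ such that for every R-module M with β(M) < ∞ one has α(M) ≤ f(β(M)). -/
open scoped DirectSum

universe u v

/-- For sum-sup invariants `α` and `β` of `R`-modules, `α` is finite on every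
`β`-finite module iff `α` is bounded by a function of `β`. -/
theorem stmt_0 {R : Type u} [Ring R]
    (α β : ∀ (M : Type v) [AddCommGroup M] [Module R M], ℕ∞)
    (hα : ∀ (I : Type v) (M : I → Type v) [∀ i, AddCommGroup (M i)] [∀ i, Module R (M i)],
      α (⨁ i, M i) = ⨆ i, α (M i))
    (hβ : ∀ (I : Type v) (M : I → Type v) [∀ i, AddCommGroup (M i)] [∀ i, Module R (M i)],
      β (⨁ i, M i) = ⨆ i, β (M i)) :
    (∀ (M : Type v) [AddCommGroup M] [Module R M], β M < ⊤ → α M < ⊤) ↔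
      (∃ f : ℕ → ℕ, ∀ (M : Type v) [AddCommGroup M] [Module R M] (n : ℕ),
        β M = (n : ℕ∞) → α M ≤ (f n : ℕ∞)) := by
  constructor
  · intro h
    suffices H : ∀ n : ℕ, ∃ k : ℕ, ∀ (M : Type v) [AddCommGroup M] [Module R M],
        β M = (n : ℕ∞) → α M ≤ (k : ℕ∞) by
      choose f hf using H
      exact ⟨f, fun M _ _ n hM => hf n M hM⟩
    intro n
    by_contra! H
    choose M hM hMod hβM hαM using H
    -- The sum of modules with `β = n` and unbounded `α` contradicts the hypothesis.
    let N : ULift.{v} ℕ → Type v := fun i => M i.down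
    have hfin : β (⨁ i, N i) < ⊤ := by
      rw [hβ]
      have hle : ⨆ i, β (N i) ≤ n := iSup_le fun i => (hβM i.down).le
      exact hle.trans_lt (ENat.natCast_lt_top n)
    have hlt := h _ hfin
    rw [hα] at hlt
    obtain ⟨k, hk⟩ := ENat.ne_top_iff_exists.mp hlt.ne
    have hle := le_iSup (fun i => α (N i)) (ULift.up k)
    rw [← hk] at hle
    exact (hαM k).not_ge hle
  · rintro ⟨f, hf⟩ M _ _ hM
    obtain ⟨n, hn⟩ := ENat.ne_top_iff_exists.mp hM.ne
    exact (hf M n hn.symm).trans_lt (ENat.natCast_lt_top _)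
end

section
/- Let C and D be abelian categories such that C has enough injectives, let F : C ⥤ D be an additive left-exact functor, and let n ≥ 1. Assume R^j F(Y) = 0 for every object Y of C and every j > n. Suppose given an exact sequence F_{n-1} → F_{n-2} → ⋯ → F_0 → M → 0 in C. Let T : C ⥤ C be an exact functor such that R^j F(T(F_i)) = 0 for all j > 0 and all 0 ≤ i ≤ n−1. Then R^j F(T(M)) = 0 for all j > 0. -/
open CategoryTheory Limits

universe u₁ v₁ u₂ v₂

section

variable {C : Type u₁} [Category.{v₁} C] [Abelian C]

/-- Precomposing the monomorphism of a left exact sequence with `e` preserves exactness if and only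
if `e` is an epimorphism. -/
lemma CategoryTheory.ShortComplex.Exact.exact_precomp_iff_epi {S : ShortComplex C} (hS : S.Exact)
    [Mono S.f] {X : C} (e : X ⟶ S.X₁) (w : (e ≫ S.f) ≫ S.g = 0) :
    (ShortComplex.mk (e ≫ S.f) S.g w).Exact ↔ Epi e := by
  constructor
  · intro h
    rw [epi_iff_surjective_up_to_refinements]
    intro A y
    obtain ⟨A', π, hπ, x, hx⟩ := h.exact_up_to_refinements (y ≫ S.f) (by simp)
    exact ⟨A', π, hπ, x, by simpa [← cancel_mono S.f] using hx⟩
  · intro _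
    let α : ShortComplex.mk (e ≫ S.f) S.g w ⟶ S :=
      { τ₁ := e
        τ₂ := 𝟙 _
        τ₃ := 𝟙 _ }
    have : Epi α.τ₁ := ‹Epi e›
    have : IsIso α.τ₂ := inferInstanceAs (IsIso (𝟙 _))
    have : Mono α.τ₃ := inferInstanceAs (Mono (𝟙 _))
    exact (ShortComplex.exact_iff_of_epi_of_isIso_of_mono α).2 hS

namespace CategoryTheory.InjectiveResolution

/-- The coaugmentation `Z ⟶ I⁰` of an injective resolution of `Z`. -/
def η {Z : C} (P : InjectiveResolution Z) : Z ⟶ P.cocomplex.X 0 := P.ι.f 0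

instance {Z : C} (P : InjectiveResolution Z) : Mono P.η :=
  inferInstanceAs (Mono (P.ι.f 0))

lemma η_d {Z : C} (P : InjectiveResolution Z) : P.η ≫ P.cocomplex.d 0 1 = 0 :=
  P.ι_f_zero_comp_complex_d

lemma exact_η_d {Z : C} (P : InjectiveResolution Z) :
    (ShortComplex.mk P.η (P.cocomplex.d 0 1) P.η_d).Exact :=
  ShortComplex.exact_of_f_is_kernel _ P.isLimitKernelFork

/-- The complex obtained by splicing an epimorphism `X₂ ⟶ X₃` with an injective resolution
of `X₃`. -/
noncomputable def spliceCocomplex (S : ShortComplex C) (P : InjectiveResolution S.X₃) :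
    CochainComplex C ℕ :=
  CochainComplex.augment P.cocomplex (S.g ≫ P.η)
    (by rw [Category.assoc, η_d, comp_zero])

/-- The injective resolution of `X₁` obtained by splicing a short exact sequence
`0 ⟶ X₁ ⟶ X₂ ⟶ X₃ ⟶ 0`, where `X₂` is injective, with an injective resolution of `X₃`. -/
noncomputable def splice {S : ShortComplex C} (hS : S.ShortExact) [hS₂ : Injective S.X₂]
    (P : InjectiveResolution S.X₃) : InjectiveResolution S.X₁ where
  cocomplex := spliceCocomplex S P
  injective
    | 0 => hS₂
    | i + 1 => P.injective i
  ι := (CochainComplex.fromSingle₀Equiv _ _).symm ⟨S.f, by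
    change S.f ≫ S.g ≫ P.η = 0
    rw [S.zero_assoc, zero_comp]⟩
  quasiIso := ⟨fun n => by
    have := hS.mono_f
    have := hS.epi_g
    obtain _ | _ | n := n
    · rw [CochainComplex.quasiIsoAt₀_iff, ShortComplex.quasiIso_iff_of_zeros]
      · have w : S.f ≫ S.g ≫ P.η = 0 := by rw [S.zero_assoc, zero_comp]
        have hex : (ShortComplex.mk S.f (S.g ≫ P.η) w).Exact := by
          let α : S ⟶ ShortComplex.mk S.f (S.g ≫ P.η) w :=
            { τ₁ := 𝟙 _
              τ₂ := 𝟙 _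
              τ₃ := P.η }
          have : Epi α.τ₁ := inferInstanceAs (Epi (𝟙 _))
          have : IsIso α.τ₂ := inferInstanceAs (IsIso (𝟙 _))
          have : Mono α.τ₃ := inferInstanceAs (Mono P.η)
          exact (ShortComplex.exact_iff_of_epi_of_isIso_of_mono α).1 hS.exact
        refine (ShortComplex.exact_and_mono_f_iff_of_iso ?_).2 ⟨hex, ‹Mono S.f›⟩
        refine ShortComplex.isoMk (Iso.refl _) (Iso.refl _) (Iso.refl _) ?_ ?_
        · exact (Category.id_comp _).trans
            ((CochainComplex.fromSingle₀Equiv_symm_apply_f_zero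
              (C := spliceCocomplex S P) S.f w).symm.trans (Category.comp_id _).symm)
        · exact (Category.id_comp _).trans (Category.comp_id _).symm
      all_goals rfl
    · rw [quasiIsoAt_iff_exactAt _ _ (CochainComplex.exactAt_succ_single_obj _ _),
        HomologicalComplex.exactAt_iff' _ 0 1 2 (by simp) (by simp)]
      exact (P.exact_η_d.exact_precomp_iff_epi S.g (by simp [η_d])).2 hS.epi_g
    · rw [quasiIsoAt_iff_exactAt _ _ (CochainComplex.exactAt_succ_single_obj _ _),
        HomologicalComplex.exactAt_iff' _ (n + 1) (n + 2) (n + 3) (by simp) (by simp)]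
      exact P.exact_succ n⟩

end CategoryTheory.InjectiveResolution

/-- The kernels of an exact pair of composable morphisms form a short exact sequence with the
first object. -/
lemma CategoryTheory.ShortComplex.Exact.shortExact_kernels {S : ShortComplex C} (hS : S.Exact) :
    (ShortComplex.mk (kernel.ι S.f) (kernel.lift S.g S.f S.zero) (by
      rw [← cancel_mono (kernel.ι S.g)]; simp)).ShortExact := by
  have := hS.epi_kernelLift
  refine .mk' ?_ inferInstance inferInstance
  let α : ShortComplex.mk (kernel.ι S.f) (kernel.lift S.g S.f S.zero) (by
      rw [← cancel_mono (kernel.ι S.g)]; simp) ⟶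
      ShortComplex.mk (kernel.ι S.f) S.f (kernel.condition _) :=
    { τ₁ := 𝟙 _
      τ₂ := 𝟙 _
      τ₃ := kernel.ι S.g }
  have : Epi α.τ₁ := inferInstanceAs (Epi (𝟙 _))
  have : IsIso α.τ₂ := inferInstanceAs (IsIso (𝟙 _))
  have : Mono α.τ₃ := inferInstanceAs (Mono (kernel.ι S.g))
  exact (ShortComplex.exact_iff_of_epi_of_isIso_of_mono α).2
    (ShortComplex.exact_of_f_is_kernel _ (kernelIsKernel S.f))

/-- Every short exact sequence embeds into a complex of injectives with short exact cokernel. -/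
lemma CategoryTheory.ShortComplex.ShortExact.exists_injective_embedding [EnoughInjectives C]
    {S : ShortComplex C} (hS : S.ShortExact) :
    ∃ (J Q : ShortComplex C) (i : S ⟶ J) (p : J ⟶ Q) (w₁ : i.τ₁ ≫ p.τ₁ = 0)
      (w₂ : i.τ₂ ≫ p.τ₂ = 0) (w₃ : i.τ₃ ≫ p.τ₃ = 0),
      Injective J.X₁ ∧ Injective J.X₂ ∧ Injective J.X₃ ∧ Q.ShortExact ∧
      (ShortComplex.mk i.τ₁ p.τ₁ w₁).ShortExact ∧ (ShortComplex.mk i.τ₂ p.τ₂ w₂).ShortExact ∧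
      (ShortComplex.mk i.τ₃ p.τ₃ w₃).ShortExact := by
  have := hS.mono_f
  have := hS.epi_g
  let J : ShortComplex C := ShortComplex.mk
    (biprod.inl : Injective.under S.X₁ ⟶ Injective.under S.X₁ ⊞ Injective.under S.X₃)
    biprod.snd (by simp)
  have hJ : J.ShortExact :=
    (ShortComplex.Splitting.ofHasBinaryBiproduct (Injective.under S.X₁)
      (Injective.under S.X₃)).shortExact
  have := hJ.mono_f
  have := hJ.epi_g
  let i : S ⟶ J :=
    { τ₁ := Injective.ι _
      τ₂ := biprod.lift (Injective.factorThru (Injective.ι _) S.f) (S.g ≫ Injective.ι _)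
      τ₃ := Injective.ι _
      comm₁₂ := by ext <;> simp [J]
      comm₂₃ := by simp [J] }
  have : Mono i.τ₁ := inferInstanceAs (Mono (Injective.ι _))
  have hi₃ : Mono i.τ₃ := inferInstanceAs (Mono (Injective.ι _))
  have : Mono i.τ₂ := ShortComplex.mono_τ₂_of_exact_of_mono i hS.exact
  let s : ShortComplex.SnakeInput C :=
    { L₀ := kernel i
      L₁ := S
      L₂ := J
      L₃ := cokernel i
      v₀₁ := kernel.ι i
      v₁₂ := i
      v₂₃ := cokernel.π i
      w₀₂ := kernel.condition i
      w₁₃ := cokernel.condition i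
      h₀ := kernelIsKernel i
      h₃ := cokernelIsCokernel i
      L₁_exact := hS.exact
      epi_L₁_g := hS.epi_g
      L₂_exact := hJ.exact
      mono_L₂_f := hJ.mono_f }
  have hp₁ : Epi s.v₂₃.τ₁ := epi_of_isColimit_cofork s.h₃τ₁
  have hp₂ : Epi s.v₂₃.τ₂ := epi_of_isColimit_cofork s.h₃τ₂
  have hp₃ : Epi s.v₂₃.τ₃ := epi_of_isColimit_cofork s.h₃τ₃
  have hQ : s.L₃.ShortExact := by
    refine .mk' s.L₃_exact ?_ ?_
    · have h0 : IsZero s.L₀.X₃ :=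
        KernelFork.IsLimit.isZero_of_mono s.h₀τ₃
      exact s.L₂'_exact.mono_g (h0.eq_of_src _ _)
    · have : Epi (s.v₂₃.τ₂ ≫ s.L₃.g) := by
        rw [s.v₂₃.comm₂₃]
        exact epi_comp' hJ.epi_g hp₃
      exact epi_of_epi s.v₂₃.τ₂ _
  refine ⟨J, s.L₃, i, s.v₂₃, s.w₁₃_τ₁, s.w₁₃_τ₂, s.w₁₃_τ₃,
    inferInstanceAs (Injective (Injective.under _)),
    inferInstanceAs (Injective (_ ⊞ _)),
    inferInstanceAs (Injective (Injective.under _)), hQ, ?_, ?_, ?_⟩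
  · exact .mk' s.exact_C₁_down ‹_› hp₁
  · exact .mk' s.exact_C₂_down ‹_› hp₂
  · exact .mk' s.exact_C₃_down ‹_› hp₃

variable {D : Type u₂} [Category.{v₂} D] [Abelian D]

lemma CategoryTheory.InjectiveResolution.isZero_rightDerived_obj_iff [HasInjectiveResolutions C]
    (F : C ⥤ D) [F.Additive] {X : C} (P : InjectiveResolution X) (n : ℕ) :
    IsZero ((F.rightDerived (n + 1)).obj X) ↔
      ((ShortComplex.mk _ _ (P.cocomplex.d_comp_d n (n + 1) (n + 2))).map F).Exact := by
  rw [(P.isoRightDerivedObj F (n + 1)).isZero_iff]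
  refine (HomologicalComplex.exactAt_iff_isZero_homology _ _).symm.trans ?_
  exact HomologicalComplex.exactAt_iff' _ n (n + 1) (n + 2) (by simp) (by simp)

namespace CategoryTheory.ShortComplex.ShortExact

variable [EnoughInjectives C] (F : C ⥤ D) [F.Additive] {S : ShortComplex C}

lemma isZero_rightDerived_succ_succ_iff (hS : S.ShortExact) [Injective S.X₂] (n : ℕ) :
    IsZero ((F.rightDerived (n + 2)).obj S.X₁) ↔ IsZero ((F.rightDerived (n + 1)).obj S.X₃) := by
  let P := InjectiveResolution.of S.X₃
  exact ((InjectiveResolution.splice hS P).isZero_rightDerived_obj_iff F (n + 1)).trans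
    (P.isZero_rightDerived_obj_iff F n).symm

variable [PreservesFiniteLimits F]

lemma isZero_rightDerived_one_iff (hS : S.ShortExact) [Injective S.X₂] :
    IsZero ((F.rightDerived 1).obj S.X₁) ↔ Epi (F.map S.g) := by
  let P := InjectiveResolution.of S.X₃
  refine ((InjectiveResolution.splice hS P).isZero_rightDerived_obj_iff F 0).trans ?_
  have hP := P.exact_η_d.map_of_mono_of_preservesKernel F
    (inferInstanceAs (Mono P.η)) inferInstance
  have : Mono ((ShortComplex.mk P.η (P.cocomplex.d 0 1) P.η_d).map F).f :=
    inferInstanceAs (Mono (F.map P.η))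
  have w : (F.map S.g ≫ F.map P.η) ≫ F.map (P.cocomplex.d 0 1) = 0 := by
    rw [← F.map_comp, ← F.map_comp, Category.assoc, P.η_d, comp_zero, F.map_zero]
  refine Iff.trans ?_ (hP.exact_precomp_iff_epi (F.map S.g) w)
  refine ShortComplex.exact_iff_of_iso
    (ShortComplex.isoMk (Iso.refl _) (Iso.refl _) (Iso.refl _) ?_ ?_)
  · exact (Category.id_comp _).trans ((F.map_comp S.g P.η).symm.trans (Category.comp_id _).symm)
  · exact (Category.id_comp _).trans (Category.comp_id _).symm

/-- If `R¹F` vanishes on the first object of a short exact sequence, then `F` preserves the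
epimorphism. -/
lemma epi_map_g_of_isZero_rightDerived_one (hS : S.ShortExact)
    (h : IsZero ((F.rightDerived 1).obj S.X₁)) : Epi (F.map S.g) := by
  have := hS.mono_f
  have := hS.epi_g
  let i := Injective.ι S.X₂
  let U : ShortComplex C := ShortComplex.mk (S.f ≫ i) (cokernel.π _) (cokernel.condition _)
  have hU : U.ShortExact := .mk'
    (ShortComplex.exact_of_g_is_cokernel _ (cokernelIsCokernel _))
    (inferInstanceAs (Mono (S.f ≫ i))) (inferInstanceAs (Epi (cokernel.π _)))
  have : Injective U.X₂ := inferInstanceAs (Injective (Injective.under _))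
  have hepi : Epi (F.map U.g) := (hU.isZero_rightDerived_one_iff F).1 h
  let c : S.X₃ ⟶ U.X₃ := hS.exact.desc (i ≫ U.g) (by
    rw [← Category.assoc]; exact U.zero)
  have hc : S.g ≫ c = i ≫ U.g := hS.exact.g_desc _ _
  let φ : S ⟶ U :=
    { τ₁ := 𝟙 _
      τ₂ := i
      τ₃ := c
      comm₁₂ := Category.id_comp _
      comm₂₃ := hc.symm }
  have : Mono c := ShortComplex.mono_of_epi_of_epi_of_mono φ hU.exact hS.epi_g
    (inferInstanceAs (Epi (𝟙 _))) (inferInstanceAs (Mono i))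
  let r : U.X₃ ⟶ cokernel i := cokernel.desc _ (cokernel.π i) (by simp)
  have hr : U.g ≫ r = cokernel.π i := cokernel.π_desc _ _ _
  let V : ShortComplex C := ShortComplex.mk i (cokernel.π i) (cokernel.condition _)
  let W : ShortComplex C := ShortComplex.mk c r (by
    rw [← cancel_epi S.g, reassoc_of% hc, hr, cokernel.condition, comp_zero])
  let ψ : V ⟶ W :=
    { τ₁ := S.g
      τ₂ := U.g
      τ₃ := 𝟙 _
      comm₁₂ := hc
      comm₂₃ := hr.trans (Category.comp_id _).symm }
  have hV : (V.map F).Exact :=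
    (ShortComplex.exact_of_g_is_cokernel V (cokernelIsCokernel i)).map_of_mono_of_preservesKernel F
      (inferInstanceAs (Mono i)) inferInstance
  exact ShortComplex.epi_of_mono_of_epi_of_mono (F.mapShortComplex.map ψ) hV
    (inferInstanceAs (Mono (F.map c))) hepi (inferInstanceAs (Mono (F.map (𝟙 _))))

/-- The exactness of `RⁿF(X₂) ⟶ RⁿF(X₃) ⟶ Rⁿ⁺¹F(X₁)` for `n > 0`, when the outer terms vanish. -/
lemma isZero_rightDerived_X₃ (hS : S.ShortExact) (n : ℕ)
    (h₂ : IsZero ((F.rightDerived (n + 1)).obj S.X₂))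
    (h₁ : IsZero ((F.rightDerived (n + 2)).obj S.X₁)) :
    IsZero ((F.rightDerived (n + 1)).obj S.X₃) := by
  induction n generalizing S with
  | zero =>
    obtain ⟨J, Q, i, p, w₁, w₂, w₃, hJ₁, hJ₂, hJ₃, hQ, e₁, e₂, e₃⟩ := hS.exists_injective_embedding
    refine (e₃.isZero_rightDerived_one_iff F).2 ?_
    have hp₂ : Epi (F.map p.τ₂) := (e₂.isZero_rightDerived_one_iff F).1 h₂
    have hg : Epi (F.map Q.g) := hQ.epi_map_g_of_isZero_rightDerived_one F
      ((e₁.isZero_rightDerived_succ_succ_iff F 0).1 h₁)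
    have : Epi (F.map J.g ≫ F.map p.τ₃) := by
      rw [← F.map_comp, ← p.comm₂₃, F.map_comp]
      infer_instance
    exact epi_of_epi (F.map J.g) _
  | succ n ih =>
    obtain ⟨J, Q, i, p, w₁, w₂, w₃, hJ₁, hJ₂, hJ₃, hQ, e₁, e₂, e₃⟩ := hS.exists_injective_embedding
    exact (e₃.isZero_rightDerived_succ_succ_iff F n).2
      (ih (S := Q) hQ ((e₂.isZero_rightDerived_succ_succ_iff F n).1 h₂)
        ((e₁.isZero_rightDerived_succ_succ_iff F (n + 1)).1 h₁))

end CategoryTheory.ShortComplex.ShortExact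

/-- Dimension shifting along a resolution by `F`-acyclic objects, presented by its syzygies `K`. -/
lemma CategoryTheory.Functor.isZero_rightDerived_of_syzygies [EnoughInjectives C]
    (F : C ⥤ D) [F.Additive] [PreservesFiniteLimits F] (n : ℕ) (K G : ℕ → C)
    (h : ∀ i < n, ∃ (f : K (i + 1) ⟶ G i) (g : G i ⟶ K i) (w : f ≫ g = 0),
      (ShortComplex.mk f g w).ShortExact)
    (hG : ∀ i < n, ∀ j, IsZero ((F.rightDerived (j + 1)).obj (G i))) (j : ℕ)
    (hK : IsZero ((F.rightDerived (j + n + 1)).obj (K n))) :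
    IsZero ((F.rightDerived (j + 1)).obj (K 0)) := by
  induction n with
  | zero => exact hK
  | succ n ih =>
    obtain ⟨f, g, w, hS⟩ := h n n.lt_succ_self
    exact ih (fun i hi => h i (hi.trans n.lt_succ_self)) (fun i hi => hG i (hi.trans n.lt_succ_self))
      (hS.isZero_rightDerived_X₃ F (j + n) (hG n n.lt_succ_self _) hK)

end

/-- If `F` is an additive left-exact functor of cohomological dimension `≤ n`
between abelian categories (the source having enough injectives),
`F_{n-1} → ⋯ → F_0 → M → 0` is exact, and `T` is an exact endofunctor of the source such
that `R^j F (T F_i) = 0` for all `j > 0` and `0 ≤ i ≤ n-1`, then `R^j F (T M) = 0` for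
all `j > 0`. -/
theorem stmt_5 {C : Type u₁} [Category.{v₁} C] {D : Type u₂} [Category.{v₂} D]
    [Abelian C] [Abelian D] [EnoughInjectives C]
    (F : C ⥤ D) [F.Additive] [PreservesFiniteLimits F]
    (n : ℕ) (hn : 1 ≤ n)
    (hdim : ∀ (Y : C) (j : ℕ), n < j → IsZero ((F.rightDerived j).obj Y))
    (Fs : ℕ → C) (M : C)
    (d : ∀ i : ℕ, Fs (i + 1) ⟶ Fs i) (ε : Fs 0 ⟶ M)
    (hw0 : d 0 ≫ ε = 0) (hwd : ∀ i, d (i + 1) ≫ d i = 0)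
    (hepi : Epi ε)
    (hex0 : (ShortComplex.mk (d 0) ε hw0).Exact)
    (hexd : ∀ i, i + 3 ≤ n → (ShortComplex.mk (d (i + 1)) (d i) (hwd i)).Exact)
    (T : C ⥤ C) [PreservesFiniteLimits T] [PreservesFiniteColimits T]
    (hvan : ∀ i, i < n → ∀ j, 0 < j → IsZero ((F.rightDerived j).obj (T.obj (Fs i)))) :
    ∀ j, 0 < j → IsZero ((F.rightDerived j).obj (T.obj M)) := by
  intro j hj
  obtain ⟨j, rfl⟩ := Nat.exists_eq_succ_of_ne_zero hj.ne'
  let K : ℕ → C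
    | 0 => M
    | 1 => kernel ε
    | i + 2 => kernel (d i)
  have hK : ∀ i < n, ∃ (f : K (i + 1) ⟶ Fs i) (g : Fs i ⟶ K i) (w : f ≫ g = 0),
      (ShortComplex.mk f g w).ShortExact
    | 0, _ => ⟨kernel.ι ε, ε, kernel.condition ε,
        .mk' (ShortComplex.exact_of_f_is_kernel _ (kernelIsKernel ε)) inferInstance hepi⟩
    | 1, _ => ⟨_, _, _, hex0.shortExact_kernels⟩
    | i + 2, hi => ⟨_, _, _, (hexd i (by omega)).shortExact_kernels⟩
  refine F.isZero_rightDerived_of_syzygies n (fun i => T.obj (K i)) (fun i => T.obj (Fs i))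
    (fun i hi => ?_) (fun i hi j => hvan i hi _ j.succ_pos) j (hdim _ _ (by omega))
  obtain ⟨f, g, w, hS⟩ := hK i hi
  exact ⟨_, _, _, hS.map_of_exact T⟩
end
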